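/- arXiv:2303.10798 — 4 statements merged into one kernel-verified Lean document; each statement's English description precedes it below -/
import Mathlib

section
/- For all integers m and n that are not both zero, the multiplicity of 2 as a factor of m² + mn + n² is even; that is, the 2-adic valuation of m² + mn + n² is an even natural number. -/
theorem even_and_even_of_even_triangular_form {m n : ℤ} (h : Even (m ^ 2 + m * n + n ^ 2)) :
    Even m ∧ Even n := by
  simp only [Int.even_add, Int.even_mul, Int.even_pow' two_ne_zero] at h
  tauto

theorem triangular_form_ne_zero {m n : ℤ} (h : ¬(m = 0 ∧ n = 0)) :
    m ^ 2 + m * n + n ^ 2 ≠ 0 := by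
  intro h0
  have hm : m = 0 := by
    rw [← sq_eq_zero_iff]
    nlinarith [sq_nonneg (m + 2 * n), sq_nonneg m]
  subst hm
  exact h ⟨rfl, by simpa using h0⟩

/-- For all integers `m` and `n` that are not both zero, the 2-adic valuation of
`m² + mn + n²` is even. -/
theorem padicValInt_two_of_triangular_form_even (m n : ℤ) (h : ¬(m = 0 ∧ n = 0)) :
    Even (padicValInt 2 (m ^ 2 + m * n + n ^ 2)) := by
  by_cases he : Even (m ^ 2 + m * n + n ^ 2)
  · obtain ⟨⟨a, rfl⟩, ⟨b, rfl⟩⟩ := even_and_even_of_even_triangular_form he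
    have hab : ¬(a = 0 ∧ b = 0) := by omega
    have hform : (a + a) ^ 2 + (a + a) * (b + b) + (b + b) ^ 2 =
        (a ^ 2 + a * b + b ^ 2) * (2 : ℕ) * (2 : ℕ) := by
      push_cast
      ring
    have hne := triangular_form_ne_zero hab
    rw [hform, padicValInt_mul_eq_succ _ (mul_ne_zero hne (by norm_num)),
      padicValInt_mul_eq_succ _ hne, add_assoc]
    exact (padicValInt_two_of_triangular_form_even a b hab).add even_two
  · rw [padicValInt.eq_zero_of_not_dvd fun hd => he (even_iff_two_dvd.2 hd)]
    exact Even.zero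
termination_by m.natAbs + n.natAbs
decreasing_by omega
end

section
/- Let T : ℝ² → ℝ² be a linear map of the Euclidean plane, and let v₁, v₂ ∈ ℝ² satisfy v₁ ≠ 0, ‖v₁‖ = ‖v₂‖, and ⟪v₁, v₂⟫ = −‖v₁‖²/2 (so v₁ and v₂ are nonzero vectors of equal length at an angle of 120°). Suppose that ‖T v₁‖ = ‖T v₂‖ and ⟪T v₁, T v₂⟫ = −‖T v₁‖²/2. Then T is a similarity: there exists c ≥ 0 such that ‖T x‖ = c·‖x‖ for all x ∈ ℝ². -/
open RealInnerProductSpace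

noncomputable section

/-- The Euclidean plane. -/
abbrev Plane : Type := EuclideanSpace ℝ (Fin 2)

theorem norm_add_sq_of_inner_eq_neg_half {E : Type*} [NormedAddCommGroup E]
    [InnerProductSpace ℝ E] {u w : E} (hlen : ‖u‖ = ‖w‖) (hang : ⟪u, w⟫ = -‖u‖ ^ 2 / 2)
    (a b : ℝ) : ‖a • u + b • w‖ ^ 2 = ‖u‖ ^ 2 * (a ^ 2 - a * b + b ^ 2) := by
  rw [norm_add_sq_real, real_inner_smul_left, real_inner_smul_right, hang, norm_smul, norm_smul,
    mul_pow, mul_pow, Real.norm_eq_abs, Real.norm_eq_abs, sq_abs, sq_abs, ← hlen]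
  ring

theorem linearIndependent_pair_of_inner_eq_neg_half {E : Type*} [NormedAddCommGroup E]
    [InnerProductSpace ℝ E] {u w : E} (hu : u ≠ 0) (hlen : ‖u‖ = ‖w‖)
    (hang : ⟪u, w⟫ = -‖u‖ ^ 2 / 2) : LinearIndependent ℝ ![u, w] := by
  rw [LinearIndependent.pair_iff]
  intro a b h
  have key := norm_add_sq_of_inner_eq_neg_half hlen hang a b
  rw [h, norm_zero, zero_pow two_ne_zero, eq_comm, mul_eq_zero] at key
  have h0 := key.resolve_left (pow_ne_zero 2 (norm_ne_zero_iff.mpr hu))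
  constructor <;> nlinarith [sq_nonneg (a - 2 * b), sq_nonneg (2 * a - b)]

/-- A linear map of the plane sending a pair of nonzero equal-length vectors at
an angle of `120°` to another such pair must be a similarity. -/
theorem similarity_of_preserves_120_pair (T : Plane →ₗ[ℝ] Plane) (v₁ v₂ : Plane)
    (hv₁ : v₁ ≠ 0) (hlen : ‖v₁‖ = ‖v₂‖) (hang : ⟪v₁, v₂⟫ = -‖v₁‖ ^ 2 / 2)
    (hlen' : ‖T v₁‖ = ‖T v₂‖) (hang' : ⟪T v₁, T v₂⟫ = -‖T v₁‖ ^ 2 / 2) :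
    ∃ c : ℝ, 0 ≤ c ∧ ∀ x : Plane, ‖T x‖ = c * ‖x‖ := by
  refine ⟨‖T v₁‖ / ‖v₁‖, by positivity, fun x => ?_⟩
  have hspan := (linearIndependent_pair_of_inner_eq_neg_half hv₁ hlen
    hang).span_eq_top_of_card_eq_finrank (by simp)
  have hx : x ∈ Submodule.span ℝ (Set.range ![v₁, v₂]) := hspan ▸ Submodule.mem_top
  rw [Matrix.range_cons_cons_empty, Submodule.mem_span_pair] at hx
  obtain ⟨a, b, rfl⟩ := hx
  have hne : ‖v₁‖ ≠ 0 := norm_ne_zero_iff.mpr hv₁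
  rw [← sq_eq_sq₀ (norm_nonneg _) (by positivity), map_add, map_smul, map_smul, mul_pow,
    norm_add_sq_of_inner_eq_neg_half hlen hang, norm_add_sq_of_inner_eq_neg_half hlen' hang']
  field_simp
end
end

section
/- Let φ = (1 + √5)/2 be the golden ratio. Then 1 + φ⁻¹ + φ⁻² = 2. Consequently, for the points A = (0,0), B = (1,0), and C = (1 + 1/(2φ), √3/(2φ)) in the Euclidean plane ℝ² (so that dist(A,B) = 1, dist(B,C) = φ⁻¹, and the angle ∠ABC equals 2π/3), one has dist(A,C) = √2, and the tangent of the angle ∠BCA equals √(3/5). -/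
noncomputable section

open Real EuclideanGeometry

/-- The golden ratio `(1 + √5)/2`. -/
def φ : ℝ := (1 + Real.sqrt 5) / 2

/-- The point `A = (0, 0)`. -/
def A : Plane := (WithLp.equiv 2 (Fin 2 → ℝ)).symm ![0, 0]

/-- The point `B = (1, 0)`. -/
def B : Plane := (WithLp.equiv 2 (Fin 2 → ℝ)).symm ![1, 0]

/-- The point `C = (1 + 1/(2φ), √3/(2φ))`. -/
def C : Plane := (WithLp.equiv 2 (Fin 2 → ℝ)).symm ![1 + 1 / (2 * φ), Real.sqrt 3 / (2 * φ)]

theorem inv_φ : φ⁻¹ = (√5 - 1) / 2 := by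
  have h5 : √5 ^ 2 = 5 := Real.sq_sqrt (by norm_num)
  refine inv_eq_of_mul_eq_one_right ?_
  rw [φ]
  linear_combination h5 / 4

theorem inv_φ_pos : 0 < φ⁻¹ := by
  rw [φ]
  positivity

theorem one_add_inv_φ_add_sq : 1 + φ⁻¹ + φ⁻¹ ^ 2 = 2 := by
  have h5 : √5 ^ 2 = 5 := Real.sq_sqrt (by norm_num)
  rw [inv_φ]
  linear_combination h5 / 4

theorem C_eq : C = !₂[1 + φ⁻¹ / 2, √3 * φ⁻¹ / 2] := by
  ext i
  fin_cases i <;> simp [C] <;> ring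

theorem dist_A_B : dist A B = 1 := by
  simp [EuclideanSpace.dist_eq, A, B]

theorem dist_B_C : dist B C = φ⁻¹ := by
  have h3 : √3 ^ 2 = 3 := Real.sq_sqrt (by norm_num)
  rw [EuclideanSpace.dist_eq, Real.sqrt_eq_iff_eq_sq (by positivity) inv_φ_pos.le, C_eq]
  simp only [B, Real.dist_eq, sq_abs, Fin.sum_univ_two, WithLp.equiv_symm_apply,
    Matrix.cons_val_zero, Matrix.cons_val_one]
  linear_combination φ⁻¹ ^ 2 / 4 * h3

theorem dist_A_C : dist A C = √2 := by
  have h3 : √3 ^ 2 = 3 := Real.sq_sqrt (by norm_num)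
  rw [EuclideanSpace.dist_eq, C_eq]
  congr 1
  simp only [A, Real.dist_eq, sq_abs, Fin.sum_univ_two, WithLp.equiv_symm_apply,
    Matrix.cons_val_zero, Matrix.cons_val_one]
  linear_combination φ⁻¹ ^ 2 / 4 * h3 + one_add_inv_φ_add_sq

theorem inner_at_B : inner ℝ (A -ᵥ B) (C -ᵥ B) = -φ⁻¹ / 2 := by
  rw [C_eq]
  simp [A, B, PiLp.inner_apply]
  ring

theorem inner_at_C : inner ℝ (B -ᵥ C) (A -ᵥ C) = φ⁻¹ * (√5 / 2) := by
  have h3 : √3 ^ 2 = 3 := Real.sq_sqrt (by norm_num)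
  have h : inner ℝ (B -ᵥ C) (A -ᵥ C) = φ⁻¹ * (φ⁻¹ + 1 / 2) := by
    rw [C_eq]
    simp [A, B, PiLp.inner_apply]
    linear_combination φ⁻¹ ^ 2 / 4 * h3
  rw [h, inv_φ]
  ring

theorem angle_A_B_C : EuclideanGeometry.angle A B C = 2 * π / 3 := by
  have hcos : cos (2 * π / 3) = -1 / 2 := by
    rw [show 2 * π / 3 = π - π / 3 by ring, cos_pi_sub, cos_pi_div_three]
    ring
  rw [EuclideanGeometry.angle, InnerProductGeometry.angle, inner_at_B, ← dist_eq_norm_vsub,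
    ← dist_eq_norm_vsub, dist_A_B, dist_comm C B, dist_B_C,
    ← arccos_cos (x := 2 * π / 3) (by positivity) (by linarith [pi_pos]), hcos]
  congr 1
  rw [one_mul, div_right_comm, neg_div, div_self inv_φ_pos.ne']

theorem tan_angle_B_C_A : tan (EuclideanGeometry.angle B C A) = √(3 / 5) := by
  have h8 : √5 / 2 / √2 = √(5 / 8) := by
    rw [eq_comm, Real.sqrt_eq_iff_eq_sq (by positivity) (by positivity), div_pow, div_pow,
      Real.sq_sqrt (by norm_num), Real.sq_sqrt (by norm_num)]
    norm_num
  rw [EuclideanGeometry.angle, InnerProductGeometry.angle, inner_at_C, ← dist_eq_norm_vsub,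
    ← dist_eq_norm_vsub, dist_A_C, dist_B_C, mul_div_mul_left _ _ inv_φ_pos.ne', h8,
    tan_arccos, Real.sq_sqrt (by norm_num), ← Real.sqrt_div' _ (by norm_num)]
  norm_num

/-- `1 + φ⁻¹ + φ⁻² = 2`; consequently the triangle `A`, `B`, `C`, which has
`dist A B = 1`, `dist B C = φ⁻¹` and a `120°` angle at `B`, satisfies
`dist A C = √2` and `tan ∠BCA = √(3/5)`. -/
theorem golden_ratio_triangle :
    1 + φ⁻¹ + φ⁻¹ ^ 2 = 2 ∧
    dist A B = 1 ∧
    dist B C = φ⁻¹ ∧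
    EuclideanGeometry.angle A B C = 2 * Real.pi / 3 ∧
    dist A C = Real.sqrt 2 ∧
    Real.tan (EuclideanGeometry.angle B C A) = Real.sqrt (3 / 5) := by
  exact ⟨one_add_inv_φ_add_sq, dist_A_B, dist_B_C, angle_A_B_C, dist_A_C, tan_angle_B_C_A⟩
end
end

section
/- There exists a set P in the Euclidean plane ℝ² such that: P is compact, equals the closure of its interior, and is homeomorphic to the closed unit disk; P admits a tiling of the plane by isometric copies; and every tiling of the plane by isometric copies of P uses both orientations, i.e., for every set S of isometries of ℝ² whose images g(P) cover ℝ² with pairwise disjoint interiors, there exist g, h ∈ S such that g is orientation-preserving (its linear part has determinant 1) and h is orientation-reversing (its linear part has determinant −1). -/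
noncomputable section

/-- `S` is a tiling of the plane by the prototile `P`: the images `g '' P` for
`g ∈ S` cover the plane and have pairwise disjoint interiors. -/
def IsTiling (P : Set Plane) (S : Set (Plane ≃ᵢ Plane)) : Prop :=
  (⋃ g ∈ S, g '' P) = Set.univ ∧
  S.Pairwise fun g h => Disjoint (interior (g '' P)) (interior (h '' P))

/-- The determinant of the linear part of an isometry of the plane. -/
def isometryLinearDet (g : Plane ≃ᵢ Plane) : ℝ :=
  LinearMap.det g.toRealAffineIsometryEquiv.linearIsometryEquiv.toLinearEquiv.toLinearMap

open Set Topology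

section Isometry

theorem linearPart_apply (g : Plane ≃ᵢ Plane) (v x : Plane) :
    g.toRealAffineIsometryEquiv.linearIsometryEquiv v = g (v + x) - g x := by
  have h := g.toRealAffineIsometryEquiv.map_vadd x v
  simp only [vadd_eq_add, IsometryEquiv.coeFn_toRealAffineIsometryEquiv] at h
  rw [h, add_sub_cancel_right]

theorem isometryLinearDet_mul (g h : Plane ≃ᵢ Plane) :
    isometryLinearDet (g * h) = isometryLinearDet g * isometryLinearDet h := by
  rw [isometryLinearDet, isometryLinearDet, isometryLinearDet, ← LinearMap.det_comp]
  congr 1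
  ext1 v
  change (g * h).toRealAffineIsometryEquiv.linearIsometryEquiv v =
    g.toRealAffineIsometryEquiv.linearIsometryEquiv
      (h.toRealAffineIsometryEquiv.linearIsometryEquiv v)
  rw [linearPart_apply _ v 0, linearPart_apply h v 0, linearPart_apply g _ (h 0),
    sub_add_cancel]
  rfl

theorem plane_decomp (v : Plane) : v = v 0 • !₂[(1 : ℝ), 0] + v 1 • !₂[(0 : ℝ), 1] := by
  ext i; fin_cases i <;> simp

theorem isometryLinearDet_eq (g : Plane ≃ᵢ Plane) {u v : Plane}
    (hu : g.toRealAffineIsometryEquiv.linearIsometryEquiv !₂[1, 0] = u)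
    (hv : g.toRealAffineIsometryEquiv.linearIsometryEquiv !₂[0, 1] = v) :
    isometryLinearDet g = u 0 * v 1 - v 0 * u 1 := by
  subst hu hv
  rw [isometryLinearDet,
    ← LinearMap.det_toMatrix (EuclideanSpace.basisFun (Fin 2) ℝ).toBasis, Matrix.det_fin_two]
  have h0 : EuclideanSpace.single (0 : Fin 2) (1 : ℝ) = !₂[(1 : ℝ), 0] := by
    ext i; fin_cases i <;> simp
  have h1 : EuclideanSpace.single (1 : Fin 2) (1 : ℝ) = !₂[(0 : ℝ), 1] := by
    ext i; fin_cases i <;> simp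
  simp [LinearMap.toMatrix_apply, h0, h1]

theorem norm_sq_plane (v : Plane) : ‖v‖ ^ 2 = v 0 ^ 2 + v 1 ^ 2 := by
  simp [EuclideanSpace.norm_sq_eq, Fin.sum_univ_two]

theorem isometryLinearDet_eq_or (g : Plane ≃ᵢ Plane) :
    isometryLinearDet g = 1 ∨ isometryLinearDet g = -1 := by
  set L := g.toRealAffineIsometryEquiv.linearIsometryEquiv with hL
  have hnorm (w : Plane) : L w 0 ^ 2 + L w 1 ^ 2 = w 0 ^ 2 + w 1 ^ 2 := by
    rw [← norm_sq_plane, ← norm_sq_plane, L.norm_map]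
  have h0 := hnorm !₂[1, 0]
  have h1 := hnorm !₂[0, 1]
  have h2 := hnorm (!₂[1, 0] + !₂[0, 1])
  rw [map_add] at h2
  rw [isometryLinearDet_eq g rfl rfl, ← hL]
  simp at h0 h1 h2 ⊢
  generalize L !₂[1, 0] 0 = a at *
  generalize L !₂[1, 0] 1 = b at *
  generalize L !₂[0, 1] 0 = c at *
  generalize L !₂[0, 1] 1 = d at *
  have h3 : a * c + b * d = 0 := by linarith
  have : (a * d - c * b) ^ 2 = (a ^ 2 + b ^ 2) * (c ^ 2 + d ^ 2) - (a * c + b * d) ^ 2 := by ring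
  rw [h0, h1, h3] at this
  exact sq_eq_one_iff.1 (by linarith)

theorem exists_eq_rotation (g : Plane ≃ᵢ Plane) (hg : isometryLinearDet g = 1) :
    ∃ a b c d : ℝ, a ^ 2 + b ^ 2 = 1 ∧
      ∀ p, g p = !₂[a * p 0 - b * p 1 + c, b * p 0 + a * p 1 + d] := by
  set L := g.toRealAffineIsometryEquiv.linearIsometryEquiv with hL
  have hnorm (w : Plane) : L w 0 ^ 2 + L w 1 ^ 2 = w 0 ^ 2 + w 1 ^ 2 := by
    rw [← norm_sq_plane, ← norm_sq_plane, L.norm_map]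
  have h0 := hnorm !₂[1, 0]
  have h1 := hnorm !₂[0, 1]
  rw [isometryLinearDet_eq g rfl rfl, ← hL] at hg
  have hp (p : Plane) : g p = p 0 • L !₂[1, 0] + p 1 • L !₂[0, 1] + g 0 := by
    rw [← map_smul, ← map_smul, ← map_add, ← plane_decomp, hL, linearPart_apply _ p 0]
    simp
  simp at h0 h1
  have h2 : L !₂[0, 1] 0 = -L !₂[1, 0] 1 := by
    nlinarith [sq_nonneg (L !₂[0, 1] 0 + L !₂[1, 0] 1), sq_nonneg (L !₂[0, 1] 1 - L !₂[1, 0] 0)]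
  have h3 : L !₂[0, 1] 1 = L !₂[1, 0] 0 := by
    nlinarith [sq_nonneg (L !₂[0, 1] 0 + L !₂[1, 0] 1), sq_nonneg (L !₂[0, 1] 1 - L !₂[1, 0] 0)]
  refine ⟨L !₂[1, 0] 0, L !₂[1, 0] 1, g 0 0, g 0 1, h0, fun p ↦ ?_⟩
  rw [hp]
  ext i; fin_cases i <;> (simp [h2, h3]; ring)

/-- The isometry of the plane `(x, y) ↦ (s x + c, y + d)`, where `s = ± 1`. -/
def axialIsometry (s : ℤˣ) (c d : ℝ) : Plane ≃ᵢ Plane :=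
  IsometryEquiv.mk'
    (fun p ↦ !₂[((s : ℤ) : ℝ) * p 0 + c, p 1 + d])
    (fun q ↦ !₂[((s : ℤ) : ℝ) * (q 0 - c), q 1 - d])
    (fun q ↦ by
      ext i
      rcases Int.units_eq_one_or s with rfl | rfl <;> fin_cases i <;> simp)
    (Isometry.of_dist_eq fun p q ↦ by
      rcases Int.units_eq_one_or s with rfl | rfl <;>
        simp [EuclideanSpace.dist_eq, Fin.sum_univ_two, Real.dist_eq, sq_abs] <;> ring_nf)

theorem mem_image_axialIsometry {s : ℤˣ} {c d : ℝ} {A : Set Plane} {p : Plane} :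
    p ∈ axialIsometry s c d '' A ↔ !₂[((s : ℤ) : ℝ) * (p 0 - c), p 1 - d] ∈ A := by
  rw [← IsometryEquiv.preimage_symm]; rfl

end Isometry

section Tiling

variable {P : Set Plane} {S : Set (Plane ≃ᵢ Plane)}

theorem IsTiling.finite_meeting_closedBall (hT : IsTiling P S) (hP : IsCompact P)
    (hne : (interior P).Nonempty) (x : Plane) (R : ℝ) :
    {g ∈ S | (g '' P ∩ Metric.closedBall x R).Nonempty}.Finite := by
  obtain ⟨c, hc⟩ := hne
  obtain ⟨r, hr, hball⟩ := Metric.isOpen_iff.1 isOpen_interior c hc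
  have himage (g : Plane ≃ᵢ Plane) : interior (g '' P) = g '' interior P :=
    (g.toHomeomorph.image_interior P).symm
  have hsep : ∀ g ∈ S, ∀ h ∈ S, dist (g c) (h c) < r → g = h := by
    intro g hg h hh hd
    by_contra hgh
    refine Set.disjoint_left.1 (hT.2 hg hh hgh) ?_ (?_ : h c ∈ _)
    · rw [himage]
      refine ⟨g.symm (h c), hball ?_, g.apply_symm_apply _⟩
      rw [Metric.mem_ball, ← g.dist_eq, g.apply_symm_apply, dist_comm]
      exact hd
    · rw [himage]
      exact mem_image_of_mem _ hc
  obtain ⟨t, ht, hcover⟩ := Metric.totallyBounded_iff.1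
    (isCompact_closedBall x (R + Metric.diam P)).totallyBounded (r / 2) (half_pos hr)
  have hmem : ∀ g ∈ {g ∈ S | (g '' P ∩ Metric.closedBall x R).Nonempty},
      ∃ y ∈ t, dist (g c) y < r / 2 := by
    rintro g ⟨-, -, ⟨q, hq, rfl⟩, hqx⟩
    have hgc : g c ∈ Metric.closedBall x (R + Metric.diam P) := by
      have h1 := dist_triangle (g c) (g q) x
      rw [g.dist_eq] at h1
      have h2 := Metric.dist_le_diam_of_mem hP.isBounded (interior_subset hc) hq
      rw [Metric.mem_closedBall] at hqx ⊢
      linarith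
    simpa using hcover hgc
  choose! f hft hfd using hmem
  refine Set.Finite.of_finite_image (f := f) (ht.subset (image_subset_iff.2 hft)) ?_
  intro g hg h hh hfgh
  have h1 := hfd g hg
  have h2 := hfd h hh
  rw [← hfgh] at h2
  exact hsep g hg.1 h hh.1 (by linarith [dist_triangle_right (g c) (h c) (f g)])

theorem IsTiling.exists_ne_mem (hT : IsTiling P S) (hP : IsCompact P)
    (hne : (interior P).Nonempty) {h : Plane ≃ᵢ Plane} {x : Plane}
    (hx : x ∈ closure (h '' P)ᶜ) : ∃ g ∈ S, g ≠ h ∧ x ∈ g '' P := by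
  set T := {g ∈ S | (g '' P ∩ Metric.closedBall x 1).Nonempty} \ {h} with hTdef
  have hfin : T.Finite := (hT.finite_meeting_closedBall hP hne x 1).sdiff
  have hclosed : IsClosed (⋃ g ∈ T, g '' P) :=
    hfin.isClosed_biUnion fun g _ ↦ (hP.image g.continuous).isClosed
  have hsub : Metric.ball x 1 ∩ (h '' P)ᶜ ⊆ ⋃ g ∈ T, g '' P := by
    rintro y ⟨hy, hyh⟩
    obtain ⟨g, hg, hyg⟩ := mem_iUnion₂.1 (hT.1.symm ▸ mem_univ y : y ∈ ⋃ g ∈ S, g '' P)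
    refine mem_iUnion₂.2 ⟨g, ⟨⟨hg, y, hyg, Metric.ball_subset_closedBall hy⟩, ?_⟩, hyg⟩
    rintro rfl
    exact hyh hyg
  have hx' := closure_minimal hsub hclosed
    (Metric.isOpen_ball.inter_closure ⟨Metric.mem_ball_self one_pos, hx⟩)
  obtain ⟨g, hg, hxg⟩ := mem_iUnion₂.1 hx'
  exact ⟨g, hg.1.1, hg.2, hxg⟩

theorem disjoint_interior_closure {X : Type*} [TopologicalSpace X] {U V : Set X}
    (hV : IsOpen V) (hUV : Disjoint U V) :
    Disjoint (interior (closure U)) (interior (closure V)) :=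
  ((((hUV.closure_left hV).mono_left interior_subset).closure_right
    isOpen_interior).mono_right interior_subset)

end Tiling

section Monotile

/-- The height of the upper side of the monotile: a V-shaped notch with apex `(2, 0)`,
whose left side rises to height `2` and whose right side rises to height `4`. -/
def ridge (x : ℝ) : ℝ := max (min 2 (4 - 2 * x)) (min 4 (2 * x - 4))

/-- The prototile: its upper side is the graph of `ridge` over `[0, 5]`, and its lower side is the
image of the upper side under the glide reflection `(x, y) ↦ (5 - x, y - 5)`. -/
def monotile : Set Plane :=
  {p | (0 ≤ p 0 ∧ p 0 ≤ 5) ∧ ridge (5 - p 0) - 5 ≤ p 1 ∧ p 1 ≤ ridge (p 0)}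

/-- The interior of the prototile. -/
def openMonotile : Set Plane :=
  {p | (0 < p 0 ∧ p 0 < 5) ∧ ridge (5 - p 0) - 5 < p 1 ∧ p 1 < ridge (p 0)}

theorem continuous_ridge : Continuous ridge := by
  unfold ridge; fun_prop

theorem ridge_nonneg (x : ℝ) : 0 ≤ ridge x := by
  unfold ridge; grind

theorem ridge_le_four (x : ℝ) : ridge x ≤ 4 := by
  unfold ridge; grind

theorem ridge_antitoneOn : AntitoneOn ridge (Iic 2) := by
  intro x hx y hy hxy
  simp only [mem_Iic] at hx hy
  unfold ridge; grind

theorem ridge_monotoneOn : MonotoneOn ridge (Ici 2) := by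
  intro x hx y hy hxy
  simp only [mem_Ici] at hx hy
  unfold ridge; grind

theorem ridge_le_ridge_add {x y d : ℝ} (h : |x - y| ≤ d) : ridge x ≤ ridge y + 2 * d := by
  rw [abs_le] at h
  unfold ridge; grind

theorem isOpen_openMonotile : IsOpen openMonotile := by
  have h := continuous_ridge
  simp only [openMonotile, ofPred_and]
  refine .inter (.inter ?_ ?_) (.inter ?_ ?_) <;> refine isOpen_lt ?_ ?_ <;> fun_prop

/-- A homeomorphism of the plane carrying the rectangle `[0, 5] × [0, 1]` to the monotile. -/
def rectangleToMonotile : Plane ≃ₜ Plane where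
  toFun p := !₂[p 0, ridge (5 - p 0) - 5 + p 1 * (ridge (p 0) - ridge (5 - p 0) + 5)]
  invFun p := !₂[p 0, (p 1 - (ridge (5 - p 0) - 5)) / (ridge (p 0) - ridge (5 - p 0) + 5)]
  left_inv p := by
    have : ridge (p 0) - ridge (5 - p 0) + 5 ≠ 0 := by
      linarith [ridge_nonneg (p 0), ridge_le_four (5 - p 0)]
    ext i; fin_cases i <;> simp [this]
  right_inv p := by
    have : ridge (p 0) - ridge (5 - p 0) + 5 ≠ 0 := by
      linarith [ridge_nonneg (p 0), ridge_le_four (5 - p 0)]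
    ext i; fin_cases i <;> simp [this]
  continuous_toFun := by
    have := continuous_ridge
    fun_prop
  continuous_invFun := by
    have := continuous_ridge
    have h (p : Plane) : ridge (p 0) - ridge (5 - p 0) + 5 ≠ 0 := by
      linarith [ridge_nonneg (p 0), ridge_le_four (5 - p 0)]
    fun_prop (disch := assumption)

/-- The open rectangle `(0, 5) × (0, 1)`. -/
def openRectangle : Set Plane :=
  EuclideanSpace.equiv (Fin 2) ℝ ⁻¹' univ.pi fun i ↦ Ioo 0 (![5, 1] i)

theorem mem_openRectangle {p : Plane} :
    p ∈ openRectangle ↔ (0 < p 0 ∧ p 0 < 5) ∧ 0 < p 1 ∧ p 1 < 1 := by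
  simp [openRectangle, Fin.forall_fin_two]

theorem closure_openRectangle : closure openRectangle =
    EuclideanSpace.equiv (Fin 2) ℝ ⁻¹' univ.pi fun i ↦ Icc 0 (![5, 1] i) := by
  rw [openRectangle, ← ContinuousLinearEquiv.coe_toHomeomorph,
    ← (EuclideanSpace.equiv (Fin 2) ℝ).toHomeomorph.preimage_closure, closure_pi_set]
  congr! 3 with i
  refine closure_Ioo ?_
  fin_cases i <;> simp

theorem mem_closure_openRectangle {p : Plane} :
    p ∈ closure openRectangle ↔ (0 ≤ p 0 ∧ p 0 ≤ 5) ∧ 0 ≤ p 1 ∧ p 1 ≤ 1 := by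
  simp only [closure_openRectangle, mem_preimage, mem_univ_pi, Fin.forall_fin_two]
  simp

theorem isOpen_openRectangle : IsOpen openRectangle :=
  (isOpen_set_pi finite_univ fun _ _ ↦ isOpen_Ioo).preimage
    (EuclideanSpace.equiv (Fin 2) ℝ).continuous

theorem convex_openRectangle : Convex ℝ openRectangle :=
  (convex_pi fun _ _ ↦ convex_Ioo _ _).linear_preimage
    (EuclideanSpace.equiv (Fin 2) ℝ).toLinearMap

theorem isCompact_closure_openRectangle : IsCompact (closure openRectangle) := by
  rw [closure_openRectangle]
  exact (EuclideanSpace.equiv (Fin 2) ℝ).toHomeomorph.isCompact_preimage.2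
    (isCompact_univ_pi fun _ ↦ isCompact_Icc)

theorem image_openRectangle : rectangleToMonotile '' openRectangle = openMonotile := by
  ext p
  have : 0 < ridge (p 0) - ridge (5 - p 0) + 5 := by
    linarith [ridge_nonneg (p 0), ridge_le_four (5 - p 0)]
  rw [← Homeomorph.preimage_symm, mem_preimage, mem_openRectangle]
  simp [rectangleToMonotile, openMonotile, div_lt_one this, div_pos_iff_of_pos_right this]
  grind

theorem image_closure_openRectangle :
    rectangleToMonotile '' closure openRectangle = monotile := by
  ext p
  have : 0 < ridge (p 0) - ridge (5 - p 0) + 5 := by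
    linarith [ridge_nonneg (p 0), ridge_le_four (5 - p 0)]
  rw [← Homeomorph.preimage_symm, mem_preimage, mem_closure_openRectangle]
  simp [rectangleToMonotile, monotile, div_le_one this, le_div_iff₀ this]

theorem closure_openMonotile : closure openMonotile = monotile := by
  rw [← image_openRectangle, ← image_closure_openRectangle, Homeomorph.image_closure]

theorem isCompact_monotile : IsCompact monotile := by
  rw [← image_closure_openRectangle]
  exact isCompact_closure_openRectangle.image rectangleToMonotile.continuous

theorem openMonotile_subset_interior : openMonotile ⊆ interior monotile :=
  interior_maximal (closure_openMonotile ▸ subset_closure) isOpen_openMonotile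

theorem openRectangle_nonempty : openRectangle.Nonempty :=
  ⟨!₂[1, 1 / 2], mem_openRectangle.2 (by norm_num)⟩

theorem nonempty_interior_monotile : (interior monotile).Nonempty :=
  (image_openRectangle ▸ openRectangle_nonempty.image _ : openMonotile.Nonempty).mono
    openMonotile_subset_interior

theorem monotile_eq_closure_interior : monotile = closure (interior monotile) := by
  refine subset_antisymm ?_ (closure_minimal interior_subset isCompact_monotile.isClosed)
  conv_lhs => rw [← closure_openMonotile]
  exact closure_mono openMonotile_subset_interior

theorem nonempty_homeomorph_monotile :
    Nonempty (monotile ≃ₜ (Metric.closedBall (0 : Plane) 1)) := by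
  obtain ⟨e, -, he, -⟩ := exists_homeomorph_image_interior_closure_frontier_eq_unitBall
    convex_openRectangle
    (isOpen_openRectangle.interior_eq.symm ▸ openRectangle_nonempty)
    (isCompact_closure_openRectangle.isBounded.subset subset_closure)
  exact ⟨((rectangleToMonotile.image (closure openRectangle)).trans
    (.setCongr image_closure_openRectangle)).symm.trans
    ((e.image (closure openRectangle)).trans (.setCongr he))⟩

end Monotile

section Existence

/-- The glide-reflected copies of the monotile stack up to fill vertical strips of width `5`. -/
def monotileTiling : Set (Plane ≃ᵢ Plane) :=
  {g | ∃ m k : ℤ, g = axialIsometry 1 (5 * m) (10 * k) ∨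
    g = axialIsometry (-1) (5 * m + 5) (10 * k + 5)}

theorem iUnion_monotileTiling : ⋃ g ∈ monotileTiling, g '' monotile = univ := by
  refine eq_univ_of_forall fun p ↦ mem_iUnion₂.2 ?_
  set m := ⌊p 0 / 5⌋
  have hm := Int.floor_le (p 0 / 5)
  have hm' := Int.lt_floor_add_one (p 0 / 5)
  set x := p 0 - 5 * m with hx
  set k := ⌊(p 1 - (ridge (5 - x) - 5)) / 10⌋
  have hk := Int.floor_le ((p 1 - (ridge (5 - x) - 5)) / 10)
  have hk' := Int.lt_floor_add_one ((p 1 - (ridge (5 - x) - 5)) / 10)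
  by_cases hp : p 1 - 10 * k ≤ ridge x
  · refine ⟨_, ⟨m, k, .inl rfl⟩, mem_image_axialIsometry.2 ?_⟩
    simp [monotile, ← hx]
    refine ⟨⟨?_, ?_⟩, ?_, ?_⟩ <;> linarith
  · refine ⟨_, ⟨m, k, .inr rfl⟩, mem_image_axialIsometry.2 ?_⟩
    have h5 : 5 * (m : ℝ) + 5 - p 0 = 5 - x := by rw [hx]; ring
    simp [monotile, h5]
    refine ⟨⟨?_, ?_⟩, ?_, ?_⟩ <;> linarith

theorem disjoint_image_openMonotile {g h : Plane ≃ᵢ Plane} (hg : g ∈ monotileTiling)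
    (hh : h ∈ monotileTiling) (hgh : g ≠ h) :
    Disjoint (g '' openMonotile) (h '' openMonotile) := by
  have key : ∀ g ∈ monotileTiling, ∀ p ∈ g '' openMonotile, ∃ m k : ℤ,
      5 * m < p 0 ∧ p 0 < 5 * m + 5 ∧
      ((g = axialIsometry 1 (5 * m) (10 * k) ∧
        ridge (5 - (p 0 - 5 * m)) - 5 < p 1 - 10 * k ∧ p 1 - 10 * k < ridge (p 0 - 5 * m)) ∨
      (g = axialIsometry (-1) (5 * m + 5) (10 * k + 5) ∧
        ridge (p 0 - 5 * m) < p 1 - 10 * k ∧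
        p 1 - 10 * k < ridge (5 - (p 0 - 5 * m)) + 5)) := by
    rintro g ⟨m, k, rfl | rfl⟩ p hp
    · rw [mem_image_axialIsometry] at hp
      simp [openMonotile] at hp
      exact ⟨m, k, by linarith, by linarith, .inl ⟨rfl, by linarith, by linarith⟩⟩
    · rw [mem_image_axialIsometry] at hp
      have h5 : 5 - (5 * (m : ℝ) + 5 - p 0) = p 0 - 5 * m := by ring
      have h5' : 5 * (m : ℝ) + 5 - p 0 = 5 - (p 0 - 5 * m) := by ring
      simp [openMonotile, h5] at hp
      rw [h5'] at hp
      exact ⟨m, k, by linarith, by linarith, .inr ⟨rfl, by linarith, by linarith⟩⟩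
  refine disjoint_left.2 fun p hpg hph ↦ hgh ?_
  obtain ⟨m, k, h1, h2, hgk⟩ := key g hg p hpg
  obtain ⟨m', k', h1', h2', hhk⟩ := key h hh p hph
  obtain rfl : m = m' := by
    have : (m : ℝ) < m' + 1 := by linarith
    have : (m' : ℝ) < m + 1 := by linarith
    norm_cast at *; omega
  have := ridge_nonneg (p 0 - 5 * m)
  have := ridge_le_four (p 0 - 5 * m)
  have := ridge_nonneg (5 - (p 0 - 5 * m))
  have := ridge_le_four (5 - (p 0 - 5 * m))
  obtain rfl : k = k' := by
    have : (k : ℝ) < k' + 1 := by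
      rcases hgk with ⟨-, _, _⟩ | ⟨-, _, _⟩ <;> rcases hhk with ⟨-, _, _⟩ | ⟨-, _, _⟩ <;> linarith
    have : (k' : ℝ) < k + 1 := by
      rcases hgk with ⟨-, _, _⟩ | ⟨-, _, _⟩ <;> rcases hhk with ⟨-, _, _⟩ | ⟨-, _, _⟩ <;> linarith
    norm_cast at *; omega
  rcases hgk with ⟨rfl, _, _⟩ | ⟨rfl, _, _⟩ <;> rcases hhk with ⟨rfl, _, _⟩ | ⟨rfl, _, _⟩ <;>
    first | rfl | linarith

theorem isTiling_monotileTiling : IsTiling monotile monotileTiling := by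
  refine ⟨iUnion_monotileTiling, fun g hg h hh hgh ↦ ?_⟩
  have himage (g : Plane ≃ᵢ Plane) : g '' monotile = closure (g '' openMonotile) := by
    rw [← closure_openMonotile]
    exact g.toHomeomorph.image_closure openMonotile
  simp only [himage]
  exact disjoint_interior_closure (h.toHomeomorph.isOpenMap _ isOpen_openMonotile)
    (disjoint_image_openMonotile hg hh hgh)

end Existence

section Forcing

/-- Every point of the monotile other than the tip of its spike is the corner of an axis-parallel
square contained in the monotile. -/
theorem exists_square_subset_monotile {p : Plane} (hp : p ∈ monotile) (hne : p ≠ !₂[3, -5]) :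
    ∃ σ τ ε : ℝ, (σ = 1 ∨ σ = -1) ∧ (τ = 1 ∨ τ = -1) ∧ 0 < ε ∧
      ∀ s ∈ Icc 0 ε, ∀ t ∈ Icc 0 ε, !₂[p 0 + σ * s, p 1 + τ * t] ∈ monotile := by
  obtain ⟨⟨h0, h5⟩, hlow, hup⟩ := hp
  generalize hx : p 0 = x at *
  generalize hy : p 1 = y at *
  simp only [monotile, mem_ofPred_eq, Matrix.cons_val_zero, Matrix.cons_val_one,
    mem_Icc]
  rcases hlow.lt_or_eq with hlow | rfl
  · have key : ∃ σ δ : ℝ, (σ = 1 ∨ σ = -1) ∧ 0 < δ ∧ ∀ s, 0 ≤ s → s ≤ δ →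
        (0 ≤ x + σ * s ∧ x + σ * s ≤ 5) ∧ ridge x ≤ ridge (x + σ * s) := by
      rcases h0.eq_or_lt with rfl | h0
      · exact ⟨1, 1, .inl rfl, one_pos, fun s _ _ ↦
          ⟨⟨by linarith, by linarith⟩, by unfold ridge; grind⟩⟩
      rcases h5.eq_or_lt with rfl | h5
      · exact ⟨-1, 1 / 2, .inr rfl, by norm_num, fun s _ _ ↦
          ⟨⟨by linarith, by linarith⟩, by unfold ridge; grind⟩⟩
      rcases le_total x 2 with h2 | h2
      · exact ⟨-1, x, .inr rfl, h0, fun s _ _ ↦ ⟨⟨by linarith, by linarith⟩,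
          ridge_antitoneOn (mem_Iic.2 (by linarith)) (mem_Iic.2 h2) (by linarith)⟩⟩
      · exact ⟨1, 5 - x, .inl rfl, by linarith, fun s _ _ ↦ ⟨⟨by linarith, by linarith⟩,
          ridge_monotoneOn (mem_Ici.2 h2) (mem_Ici.2 (by linarith)) (by linarith)⟩⟩
    obtain ⟨σ, δ, hσ, hδ, h⟩ := key
    refine ⟨σ, -1, min δ ((y - (ridge (5 - x) - 5)) / 3), hσ, .inr rfl,
      lt_min hδ (by linarith), fun s ⟨hs, hs'⟩ t ⟨ht, ht'⟩ ↦ ?_⟩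
    rw [le_min_iff] at hs' ht'
    obtain ⟨hx, hr⟩ := h s hs hs'.1
    have := ridge_le_ridge_add (x := 5 - (x + σ * s)) (y := 5 - x) (d := s)
      (by rcases hσ with rfl | rfl <;> simp [abs_of_nonneg hs])
    exact ⟨hx, by linarith, by linarith⟩
  · have key : ∃ σ δ : ℝ, (σ = 1 ∨ σ = -1) ∧ 0 < δ ∧ ∀ s, 0 ≤ s → s ≤ δ →
        (0 ≤ x + σ * s ∧ x + σ * s ≤ 5) ∧ ridge (5 - (x + σ * s)) ≤ ridge (5 - x) := by
      rcases lt_trichotomy x 3 with h3 | rfl | h3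
      · exact ⟨1, 3 - x, .inl rfl, by linarith, fun s _ _ ↦ ⟨⟨by linarith, by linarith⟩,
          ridge_monotoneOn (mem_Ici.2 (by linarith)) (mem_Ici.2 (by linarith)) (by linarith)⟩⟩
      · refine absurd ?_ hne
        ext i; fin_cases i
        · simpa using hx
        · simp [hy]; norm_num [ridge]
      · exact ⟨-1, x - 3, .inr rfl, by linarith, fun s _ _ ↦ ⟨⟨by linarith, by linarith⟩,
          ridge_antitoneOn (mem_Iic.2 (by linarith)) (mem_Iic.2 (by linarith)) (by linarith)⟩⟩
    obtain ⟨σ, δ, hσ, hδ, h⟩ := key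
    refine ⟨σ, 1, min δ (1 / 3), hσ, .inl rfl,
      lt_min hδ (by norm_num), fun s ⟨hs, hs'⟩ t ⟨ht, ht'⟩ ↦ ?_⟩
    rw [le_min_iff] at hs' ht'
    obtain ⟨hx, hr⟩ := h s hs hs'.1
    have := ridge_le_ridge_add (x := x) (y := x + σ * s) (d := s)
      (by rcases hσ with rfl | rfl <;> simp [abs_of_nonneg hs])
    have := ridge_nonneg x
    have := ridge_le_four (5 - x)
    exact ⟨hx, by linarith, by linarith⟩

/-- Near the apex of the notch, the open monotile contains every point outside the notch. -/
theorem two_mul_abs_le_of_notMem_openMonotile {x y : ℝ} (hx : |x| < 1) (hy : |y| < 1)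
    (h : !₂[2 + x, y] ∉ openMonotile) : 2 * |x| ≤ y := by
  contrapose! h
  simp only [openMonotile, mem_ofPred_eq, Matrix.cons_val_zero,
    Matrix.cons_val_one]
  unfold ridge; grind

theorem not_disjoint_openMonotile_image {a b c d : ℝ} (hab : a ^ 2 + b ^ 2 = 1)
    {k : Plane ≃ᵢ Plane} (hk : ∀ p, k p = !₂[a * p 0 - b * p 1 + c, b * p 0 + a * p 1 + d])
    (hV : !₂[2, 0] ∈ k '' monotile) : ¬ Disjoint openMonotile (k '' monotile) := by
  intro hd
  obtain ⟨p, hp, hpV⟩ := hV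
  have hout {q : Plane} (hq : q ∈ monotile) : k q ∉ openMonotile :=
    fun h ↦ disjoint_left.1 hd h (mem_image_of_mem _ hq)
  have ha : |a| ≤ 1 := abs_le.2 ⟨by nlinarith, by nlinarith⟩
  have hb : |b| ≤ 1 := abs_le.2 ⟨by nlinarith, by nlinarith⟩
  have hc : a * p 0 - b * p 1 + c = 2 := by simpa [hk] using congrArg (· 0) hpV
  have hd' : b * p 0 + a * p 1 + d = 0 := by simpa [hk] using congrArg (· 1) hpV
  have hcone {x y δ : ℝ} (hδ : 0 < δ) (hδ' : δ ≤ 1 / 4) (hx : |x| ≤ 1) (hy : |y| ≤ 2)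
      (h : !₂[p 0 + δ * x, p 1 + δ * y] ∈ monotile) :
      2 * |a * x - b * y| ≤ b * x + a * y := by
    have h1 := hout h
    rw [hk] at h1
    have e1 : a * (p 0 + δ * x) - b * (p 1 + δ * y) + c = 2 + δ * (a * x - b * y) := by
      linear_combination hc
    have e2 : b * (p 0 + δ * x) + a * (p 1 + δ * y) + d = δ * (b * x + a * y) := by
      linear_combination hd'
    simp only [Matrix.cons_val_zero, Matrix.cons_val_one] at h1
    rw [e1, e2] at h1
    have hsmall {z : ℝ} (hz : |z| < 4) : |δ * z| < 1 := by
      rw [abs_mul, abs_of_pos hδ]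
      nlinarith [abs_nonneg z]
    have hmul {u z m : ℝ} (hu : |u| ≤ 1) (hz : |z| ≤ m) : |u * z| ≤ m := by
      rw [abs_mul]
      nlinarith [abs_nonneg z]
    have h2 : |a * x - b * y| < 4 := by
      linarith [abs_sub (a * x) (b * y), hmul ha hx, hmul hb hy]
    have h3 : |b * x + a * y| < 4 := by
      linarith [abs_add_le (b * x) (a * y), hmul hb hx, hmul ha hy]
    have h4 := two_mul_abs_le_of_notMem_openMonotile (hsmall h2) (hsmall h3) h1
    rw [abs_mul, abs_of_pos hδ, mul_left_comm] at h4
    exact le_of_mul_le_mul_left h4 hδ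
  by_cases hW : p = !₂[3, -5]
  · have hspike {x : ℝ} (hx : |x| = 1) :
        !₂[p 0 + 1 / 4 * x, p 1 + 1 / 4 * 2] ∈ monotile := by
      rw [hW]
      simp only [monotile, mem_ofPred_eq, Matrix.cons_val_zero,
        Matrix.cons_val_one]
      unfold ridge
      rcases eq_or_eq_neg_of_abs_eq hx with rfl | rfl <;> norm_num
    have h1 := hcone (by norm_num) le_rfl (by simp) (by simp) (hspike abs_one)
    have h2 := hcone (by norm_num) le_rfl (by simp) (by simp) (hspike (x := -1) (by simp))
    have h1' := le_abs_self (a * 1 - b * 2)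
    have h2' := neg_abs_le (a * -1 - b * 2)
    obtain rfl : b = 0 := by linarith
    obtain rfl : a = 1 := by
      have := abs_nonneg (a * 1 - 0 * 2)
      nlinarith
    have hmem : !₂[9 / 2, -5 / 2] ∈ monotile := by
      simp [monotile, ridge]; norm_num
    refine hout hmem ?_
    rw [hW] at hc hd'
    simp at hc hd'
    rw [hk]
    obtain rfl : c = -1 := by linarith
    obtain rfl : d = 5 := by linarith
    simp [openMonotile, ridge]; norm_num
  · obtain ⟨σ, τ, ε, hσ, hτ, hε, h⟩ := exists_square_subset_monotile hp hW
    have hδ : 0 < min ε (1 / 4) := lt_min hε (by norm_num)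
    have hσ' : |σ| ≤ 1 := by rcases hσ with rfl | rfl <;> simp
    have hτ' : |τ| ≤ 2 := by rcases hτ with rfl | rfl <;> simp
    have h1 := hcone hδ (min_le_right _ _) hσ' (y := 0) (by simp) (by
      simpa [mul_comm] using h (min ε (1 / 4)) ⟨hδ.le, min_le_left _ _⟩ 0 ⟨le_rfl, hε.le⟩)
    have h2 := hcone hδ (min_le_right _ _) (x := 0) (by simp) hτ' (by
      simpa [mul_comm] using h 0 ⟨le_rfl, hε.le⟩ (min ε (1 / 4)) ⟨hδ.le, min_le_left _ _⟩)
    have h3 : 2 * |a| ≤ |b| := by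
      refine le_trans (le_trans (le_of_eq ?_) h1) (le_trans (le_abs_self _) (le_of_eq ?_)) <;>
        rcases hσ with rfl | rfl <;> simp
    have h4 : 2 * |b| ≤ |a| := by
      refine le_trans (le_trans (le_of_eq ?_) h2) (le_trans (le_abs_self _) (le_of_eq ?_)) <;>
        rcases hτ with rfl | rfl <;> simp
    have ha0 : a = 0 := abs_eq_zero.1 (by linarith [abs_nonneg a, abs_nonneg b])
    have hb0 : b = 0 := abs_eq_zero.1 (by linarith [abs_nonneg a, abs_nonneg b])
    simp [ha0, hb0] at hab

theorem mem_closure_compl_monotile : !₂[2, 0] ∈ closure monotileᶜ := by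
  have ht : Filter.Tendsto (fun t : ℝ ↦ (!₂[2, t] : Plane)) (𝓝[>] 0) (𝓝 !₂[2, 0]) :=
    (Continuous.tendsto (by fun_prop) 0).mono_left nhdsWithin_le_nhds
  refine mem_closure_of_tendsto ht ?_
  filter_upwards [self_mem_nhdsWithin] with t ht
  simp only [mem_Ioi] at ht
  simp [monotile, ridge]
  intros
  constructor <;> intro <;> linarith

theorem IsTiling.exists_isometryLinearDet_ne {S : Set (Plane ≃ᵢ Plane)}
    (hT : IsTiling monotile S) {h : Plane ≃ᵢ Plane} (hh : h ∈ S) :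
    ∃ g ∈ S, isometryLinearDet g ≠ isometryLinearDet h := by
  have hx : h !₂[2, 0] ∈ closure (h '' monotile)ᶜ := by
    rw [← image_compl_eq h.bijective]
    exact (h.toHomeomorph.image_closure _).subset (mem_image_of_mem h mem_closure_compl_monotile)
  obtain ⟨g, hg, hgh, hxg⟩ :=
    hT.exists_ne_mem isCompact_monotile nonempty_interior_monotile hx
  refine ⟨g, hg, fun hdet ↦ ?_⟩
  have himage : h '' ((h⁻¹ * g) '' monotile) = g '' monotile := by
    rw [← image_comp, ← IsometryEquiv.coe_mul, mul_inv_cancel_left]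
  have hk : isometryLinearDet (h⁻¹ * g) = 1 := by
    have h1 := isometryLinearDet_mul h (h⁻¹ * g)
    rw [mul_inv_cancel_left, hdet] at h1
    exact (mul_eq_left₀ (by rcases isometryLinearDet_eq_or h with e | e <;> simp [e])).1 h1.symm
  obtain ⟨a, b, c, d, hab, hform⟩ := exists_eq_rotation _ hk
  refine not_disjoint_openMonotile_image hab hform ?_ ?_
  · rwa [← h.injective.mem_set_image, himage]
  · rw [← disjoint_image_iff h.injective, himage, monotile_eq_closure_interior]
    have hd := hT.2 hh hg hgh.symm
    have e1 : interior (g '' monotile) = g '' interior monotile :=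
      (g.toHomeomorph.image_interior _).symm
    have e2 : interior (h '' monotile) = h '' interior monotile :=
      (h.toHomeomorph.image_interior _).symm
    have e3 : g '' closure (interior monotile) = closure (g '' interior monotile) :=
      g.toHomeomorph.image_closure _
    rw [e3, ← e1]
    refine (hd.mono_left ?_).closure_right (h.toHomeomorph.isOpenMap _ isOpen_openMonotile)
    rw [e2]
    exact image_mono openMonotile_subset_interior

end Forcing

/-- There is a closed topological disk that tiles the plane and every tiling of
the plane by its isometric copies uses both an orientation-preserving and an
orientation-reversing copy. -/
theorem monotile_forcing_reflections_exists :
    ∃ P : Set Plane,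
      IsCompact P ∧
      P = closure (interior P) ∧
      Nonempty (P ≃ₜ (Metric.closedBall (0 : Plane) 1)) ∧
      (∃ S : Set (Plane ≃ᵢ Plane), IsTiling P S) ∧
      (∀ S : Set (Plane ≃ᵢ Plane), IsTiling P S →
        (∃ g ∈ S, isometryLinearDet g = 1) ∧ (∃ h ∈ S, isometryLinearDet h = -1)) := by
  refine ⟨monotile, isCompact_monotile, monotile_eq_closure_interior,
    nonempty_homeomorph_monotile, ⟨_, isTiling_monotileTiling⟩, fun S hT ↦ ?_⟩
  obtain ⟨h, hh, -⟩ := mem_iUnion₂.1 (hT.1.symm ▸ mem_univ 0 : (0 : Plane) ∈ ⋃ g ∈ S, g '' monotile)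
  obtain ⟨g, hg, hgh⟩ := hT.exists_isometryLinearDet_ne hh
  rcases isometryLinearDet_eq_or h with h1 | h1 <;>
    rcases isometryLinearDet_eq_or g with g1 | g1
  · exact absurd (g1.trans h1.symm) hgh
  · exact ⟨⟨h, hh, h1⟩, g, hg, g1⟩
  · exact ⟨⟨g, hg, g1⟩, h, hh, h1⟩
  · exact absurd (g1.trans h1.symm) hgh
end
end
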